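/- For every α ≥ 0 with α ≠ 1 and every β > 1, the Sharma–Mittal entropy is subadditive on the majorization lattice: for all p, q ∈ P_n and r ∈ P_n satisfying Σ_{i=1}^k r_i = min(Σ_{i=1}^k p_i, Σ_{i=1}^k q_i) for all k = 1, …, n (so r = p ∧ q is the greatest lower bound of p and q), one has S_{α,β}(r) ≤ S_{α,β}(p) + S_{α,β}(q). -/

import Mathlib

open Finset Real

/-- `p` is a probability vector: nonnegative, non-increasing entries summing to 1. -/
def IsProbVec {n : ℕ} (p : Fin n → ℝ) : Prop :=
  (∀ i, 0 ≤ p i) ∧ (∀ i j : Fin n, i ≤ j → p j ≤ p i) ∧ ∑ i, p i = 1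

/-- The sum of the first `k` entries of `p`. -/
noncomputable def partialSum {n : ℕ} (p : Fin n → ℝ) (k : ℕ) : ℝ :=
  ∑ i : Fin n, if (i : ℕ) < k then p i else 0

/-- `p` is majorized by `q` (`p ⪯ q`). -/
def MajorizedBy {n : ℕ} (p q : Fin n → ℝ) : Prop :=
  ∀ k : ℕ, k ≤ n → partialSum p k ≤ partialSum q k

/-- The Sharma–Mittal entropy of order `(α, β)`. -/
noncomputable def sharmaMittal (α β : ℝ) {n : ℕ} (p : Fin n → ℝ) : ℝ :=
  (1 / (1 - β)) * ((∑ i, p i ^ α) ^ ((1 - β) / (1 - α)) - 1)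

/-- Abel summation: an antitone weight paired with a sequence whose partial sums are nonnegative
and whose total is zero gives a nonnegative sum. -/
lemma sum_mul_nonneg_of_partial_sums_nonneg (w d : ℕ → ℝ) (m : ℕ)
    (hw : ∀ k, k + 1 < m → w (k + 1) ≤ w k)
    (hd : ∀ k, 0 ≤ ∑ i ∈ range k, d i) (h0 : ∑ i ∈ range m, d i = 0) :
    0 ≤ ∑ i ∈ range m, w i * d i := by
  cases m with
  | zero => simp
  | succ m =>
    have key : ∀ k, k ≤ m → w k * ∑ i ∈ range (k + 1), d i ≤ ∑ i ∈ range (k + 1), w i * d i := by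
      intro k
      induction k with
      | zero => simp
      | succ k ih =>
        intro hk
        rw [sum_range_succ _ (k + 1), sum_range_succ (fun i => w i * d i) (k + 1), mul_add]
        have h1 := ih (by omega)
        have h2 := mul_le_mul_of_nonneg_right (hw k (by omega)) (hd (k + 1))
        linarith
    have h := key m le_rfl
    rwa [h0, mul_zero] at h

/-- The tangent line inequality for `x ↦ x ^ α` with `1 < α`. -/
lemma rpow_add_mul_sub_le_rpow {α x y : ℝ} (hα : 1 < α) (hx : 0 < x) (hy : 0 ≤ y) :
    x ^ α + α * x ^ (α - 1) * (y - x) ≤ y ^ α := by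
  have h := one_add_mul_self_le_rpow_one_add (s := y / x - 1)
    (by linarith [div_nonneg hy hx.le]) hα.le
  rw [add_sub_cancel, div_rpow hy hx.le, le_div_iff₀ (rpow_pos_of_pos hx α)] at h
  refine le_trans (le_of_eq ?_) h
  rw [rpow_sub_one hx.ne']
  field_simp

/-- The tangent line inequality for `x ↦ x ^ α` with `0 ≤ α ≤ 1`. -/
lemma rpow_le_rpow_add_mul_sub {α x y : ℝ} (hα0 : 0 ≤ α) (hα : α ≤ 1) (hx : 0 < x)
    (hy : 0 ≤ y) : y ^ α ≤ x ^ α + α * x ^ (α - 1) * (y - x) := by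
  have h := rpow_one_add_le_one_add_mul_self (s := y / x - 1)
    (by linarith [div_nonneg hy hx.le]) hα0 hα
  rw [add_sub_cancel, div_rpow hy hx.le, div_le_iff₀ (rpow_pos_of_pos hx α)] at h
  refine le_trans h (le_of_eq ?_)
  rw [rpow_sub_one hx.ne']
  field_simp

lemma exists_pos_iff_lt {X : ℕ → ℝ} {N : ℕ} (hX : Antitone X) (hX0 : ∀ k, 0 ≤ X k)
    (hN : X N = 0) : ∃ m ≤ N, (∀ k < m, 0 < X k) ∧ ∀ k, m ≤ k → X k = 0 := by
  classical
  have hex : ∃ k, X k = 0 := ⟨N, hN⟩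
  refine ⟨Nat.find hex, Nat.find_min' hex hN, fun k hk => ?_, fun k hk => ?_⟩
  · exact lt_of_le_of_ne (hX0 k) (Ne.symm (Nat.find_min hex hk))
  · exact le_antisymm ((hX hk).trans_eq (Nat.find_spec hex)) (hX0 k)

lemma sum_range_eq_of_eq_zero {f : ℕ → ℝ} {m N : ℕ} (hmN : m ≤ N)
    (hf : ∀ k, m ≤ k → k < N → f k = 0) : ∑ k ∈ range N, f k = ∑ k ∈ range m, f k := by
  refine (sum_subset (range_subset_range.2 hmN) fun k hk hk' => ?_).symm
  exact hf k (by simpa using hk') (by simpa using hk)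

/-- Schur monotonicity of power sums for finitely supported sequences. -/
lemma sum_rpow_majorization_range {X R : ℕ → ℝ} {N : ℕ} {α : ℝ} (hX : Antitone X)
    (hX0 : ∀ k, 0 ≤ X k) (hR0 : ∀ k, 0 ≤ R k) (hXN : X N = 0)
    (hle : ∀ k, ∑ i ∈ range k, X i ≤ ∑ i ∈ range k, R i)
    (htot : ∑ i ∈ range N, X i = ∑ i ∈ range N, R i) (hα0 : 0 < α) :
    (1 < α → ∑ i ∈ range N, X i ^ α ≤ ∑ i ∈ range N, R i ^ α) ∧
      (α < 1 → ∑ i ∈ range N, R i ^ α ≤ ∑ i ∈ range N, X i ^ α) := by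
  obtain ⟨m, hmN, hpos, hzero⟩ := exists_pos_iff_lt hX hX0 hXN
  have hXm := sum_range_eq_of_eq_zero hmN fun k hk _ => hzero k hk
  have hRm : ∑ i ∈ range m, R i = ∑ i ∈ range N, R i :=
    le_antisymm (sum_le_sum_of_subset_of_nonneg (range_subset_range.2 hmN) fun i _ _ => hR0 i)
      (by rw [← htot, hXm]; exact hle m)
  have hRzero : ∀ k, m ≤ k → k < N → R k = 0 := by
    rw [← sum_range_add_sum_Ico R hmN, left_eq_add,
      sum_eq_zero_iff_of_nonneg fun i _ => hR0 i] at hRm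
    exact fun k hk hk' => hRm k (mem_Ico.2 ⟨hk, hk'⟩)
  rw [sum_range_eq_of_eq_zero (f := fun i => X i ^ α) hmN
      fun k hk _ => by simp only [hzero k hk, zero_rpow hα0.ne'],
    sum_range_eq_of_eq_zero (f := fun i => R i ^ α) hmN
      fun k hk hk' => by simp only [hRzero k hk hk', zero_rpow hα0.ne']]
  have hd : ∀ k, 0 ≤ ∑ i ∈ range k, (R i - X i) := fun k => by
    rw [sum_sub_distrib]; linarith [hle k]
  have hd0 : ∑ i ∈ range m, (R i - X i) = 0 := by
    rw [sum_sub_distrib]; linarith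
  constructor
  · intro hα
    have h := sum_mul_nonneg_of_partial_sums_nonneg (fun k => α * X k ^ (α - 1)) _ m
      (fun k _ => mul_le_mul_of_nonneg_left
        (rpow_le_rpow (hX0 _) (hX k.le_succ) (by linarith)) hα0.le) hd hd0
    have h' := sum_le_sum fun i (hi : i ∈ range m) =>
      rpow_add_mul_sub_le_rpow hα (hpos i (mem_range.1 hi)) (hR0 i)
    rw [sum_add_distrib] at h'
    linarith
  · intro hα
    have h := sum_mul_nonneg_of_partial_sums_nonneg (fun k => -(α * X k ^ (α - 1))) _ m
      (fun k hk => neg_le_neg <| mul_le_mul_of_nonneg_left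
        (rpow_le_rpow_of_nonpos (hpos _ hk) (hX k.le_succ) (by linarith)) hα0.le) hd hd0
    have h' := sum_le_sum fun i (hi : i ∈ range m) =>
      rpow_le_rpow_add_mul_sub hα0.le hα.le (hpos i (mem_range.1 hi)) (hR0 i)
    rw [sum_add_distrib] at h'
    simp only [neg_mul, sum_neg_distrib] at h
    linarith

lemma partialSum_eq_sum_range {n : ℕ} (p : Fin n → ℝ) (k : ℕ) :
    partialSum p k = ∑ i ∈ range k, if h : i < n then p ⟨i, h⟩ else 0 := by
  induction k with
  | zero => simp [partialSum]
  | succ k ih =>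
    rw [sum_range_succ, ← ih, partialSum, partialSum]
    have hsplit : ∀ i : Fin n, (if (i : ℕ) < k + 1 then p i else 0) =
        (if (i : ℕ) < k then p i else 0) + if (i : ℕ) = k then p i else 0 := by
      intro i
      rcases lt_trichotomy (i : ℕ) k with h | h | h
      · simp [h, h.ne, h.trans k.lt_succ_self]
      · simp [h]
      · simp [h.not_gt, h.ne', show ¬ (i : ℕ) < k + 1 by omega]
    simp only [hsplit, sum_add_distrib, add_right_inj]
    split_ifs with h
    · rw [sum_eq_single ⟨k, h⟩] <;> simp +contextual [Fin.ext_iff]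
    · exact sum_eq_zero fun i _ => if_neg (by omega)

lemma partialSum_of_le {n : ℕ} (p : Fin n → ℝ) {k : ℕ} (hk : n ≤ k) :
    partialSum p k = ∑ i, p i :=
  sum_congr rfl fun i _ => if_pos (i.2.trans_le hk)

/-- The first `k` entries of a non-increasing nonnegative vector have the largest sum. -/
lemma sum_le_partialSum {n : ℕ} {p : Fin n → ℝ} (hp0 : ∀ i, 0 ≤ p i)
    (hp : ∀ i j : Fin n, i ≤ j → p j ≤ p i) (S : Finset (Fin n)) {k : ℕ} (hS : #S ≤ k) :
    ∑ i ∈ S, p i ≤ partialSum p k := by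
  rcases le_or_gt n k with hk | hk
  · rw [partialSum_of_le p hk]
    exact sum_le_sum_of_subset_of_nonneg (subset_univ S) fun i _ _ => hp0 i
  set c := p ⟨k, hk⟩ with hc
  have h1 : ∑ i ∈ S, (p i - c) ≤ ∑ i : Fin n, if (i : ℕ) < k then p i - c else 0 := by
    calc ∑ i ∈ S, (p i - c) ≤ ∑ i ∈ S, if (i : ℕ) < k then p i - c else 0 := by
          refine sum_le_sum fun i _ => ?_
          split_ifs with h
          · exact le_rfl
          · exact sub_nonpos.2 (hp ⟨k, hk⟩ i (not_lt.1 h))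
      _ ≤ _ := by
          refine sum_le_sum_of_subset_of_nonneg (subset_univ S) fun i _ _ => ?_
          split_ifs with h
          · exact sub_nonneg.2 (hp i ⟨k, hk⟩ h.le)
          · exact le_rfl
  have h2 : (∑ i : Fin n, if (i : ℕ) < k then p i - c else 0) = partialSum p k - k * c := by
    have h3 : partialSum (fun _ : Fin n => c) k = k * c := by
      rw [partialSum_eq_sum_range,
        sum_congr rfl fun i hi => dif_pos ((mem_range.1 hi).trans hk)]
      simp
    rw [← h3, partialSum, partialSum, ← sum_sub_distrib]
    refine sum_congr rfl fun i _ => ?_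
    split_ifs <;> simp
  rw [h2, sum_sub_distrib, sum_const, nsmul_eq_mul] at h1
  have h4 : (#S : ℝ) * c ≤ k * c :=
    mul_le_mul_of_nonneg_right (by exact_mod_cast hS) (hp0 _)
  linarith

/-- A family indexed by a finite type can be enumerated in non-increasing order. -/
lemma exists_equiv_antitone {ι : Type*} [Fintype ι] (x : ι → ℝ) :
    ∃ (C : ℕ) (e : Fin C ≃ ι), Antitone (x ∘ e) := by
  let e₀ := (Fintype.equivFin ι).symm
  let σ := Tuple.sort fun i => -x (e₀ i)
  refine ⟨_, σ.trans e₀, fun i j hij => ?_⟩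
  have h : -x (e₀ (σ i)) ≤ -x (e₀ (σ j)) := Tuple.monotone_sort (fun i => -x (e₀ i)) hij
  exact neg_le_neg_iff.1 h

/-- Schur monotonicity of power sums when a finite family `x` is majorized by a probability
vector `r`, the two possibly having different lengths. -/
lemma sum_rpow_majorization {ι : Type*} [Fintype ι] {n : ℕ} {x : ι → ℝ} {r : Fin n → ℝ} {α : ℝ}
    (hx0 : ∀ i, 0 ≤ x i) (hx : ∑ i, x i = 1) (hr : IsProbVec r)
    (hle : ∀ T : Finset ι, ∑ i ∈ T, x i ≤ partialSum r #T) (hα0 : 0 < α) :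
    (1 < α → ∑ i, x i ^ α ≤ ∑ i, r i ^ α) ∧ (α < 1 → ∑ i, r i ^ α ≤ ∑ i, x i ^ α) := by
  obtain ⟨C, e, he⟩ := exists_equiv_antitone x
  let X : ℕ → ℝ := fun k => if h : k < C then (x ∘ e) ⟨k, h⟩ else 0
  let R : ℕ → ℝ := fun k => if h : k < n then r ⟨k, h⟩ else 0
  have hX0 : ∀ k, 0 ≤ X k := fun k => by
    simp only [X]; split_ifs
    · exact hx0 _
    · exact le_rfl
  have hR0 : ∀ k, 0 ≤ R k := fun k => by
    simp only [R]; split_ifs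
    · exact hr.1 _
    · exact le_rfl
  have hX : Antitone X := fun i j hij => by
    by_cases hj : j < C
    · simp only [X, dif_pos hj, dif_pos (hij.trans_lt hj)]
      exact he (Fin.mk_le_mk.2 hij)
    · simpa only [X, dif_neg hj] using hX0 i
  have hXtot : ∑ i ∈ range (max C n), X i = 1 :=
    (partialSum_eq_sum_range (x ∘ e) _).symm.trans <|
      (partialSum_of_le _ (le_max_left C n)).trans <| (e.sum_comp x).trans hx
  have hRtot : ∑ i ∈ range (max C n), R i = 1 := by
    rw [← hr.2.2, ← partialSum_of_le r (le_max_right C n), partialSum_eq_sum_range]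
  have hmono : ∀ k l, k ≤ l → partialSum r k ≤ partialSum r l := fun k l hkl => by
    rw [partialSum_eq_sum_range, partialSum_eq_sum_range]
    exact sum_le_sum_of_subset_of_nonneg (range_subset_range.2 hkl) fun i _ _ => hR0 i
  have hXR : ∀ k, ∑ i ∈ range k, X i ≤ ∑ i ∈ range k, R i := by
    intro k
    have h1 := hle (({i : Fin C | (i : ℕ) < k} : Finset (Fin C)).map e.toEmbedding)
    rw [sum_map, card_map, sum_filter] at h1
    have h2 : #({i : Fin C | (i : ℕ) < k} : Finset (Fin C)) ≤ k := by
      rw [← card_map Fin.valEmbedding]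
      refine (card_le_card fun a ha => ?_).trans_eq (card_range k)
      obtain ⟨i, hi, rfl⟩ := mem_map.1 ha
      simpa using hi
    have h3 := h1.trans (hmono _ _ h2)
    rw [← partialSum_eq_sum_range r, ← partialSum_eq_sum_range (x ∘ e)]
    exact h3
  have hsumX : ∑ i ∈ range (max C n), X i ^ α = ∑ i, x i ^ α := by
    rw [← e.sum_comp fun i => x i ^ α, ← partialSum_of_le _ (le_max_left C n),
      partialSum_eq_sum_range]
    refine sum_congr rfl fun i _ => ?_
    simp only [X]; split_ifs
    · rfl
    · exact zero_rpow hα0.ne'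
  have hsumR : ∑ i ∈ range (max C n), R i ^ α = ∑ i, r i ^ α := by
    rw [← partialSum_of_le (fun i => r i ^ α) (le_max_right C n), partialSum_eq_sum_range]
    refine sum_congr rfl fun i _ => ?_
    simp only [R]; split_ifs
    · rfl
    · exact zero_rpow hα0.ne'
  rw [← hsumX, ← hsumR]
  exact sum_rpow_majorization_range hX hX0 hR0
    (dif_neg (not_lt.2 (le_max_left C n))) hXR (hXtot.trans hRtot.symm) hα0

/-- Any `k` entries of the product distribution sum to at most the `k` largest entries of the
first marginal. -/
lemma sum_mul_le_partialSum {ι : Type*} [Fintype ι] {n : ℕ} {p : Fin n → ℝ} {q : ι → ℝ}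
    (hp : IsProbVec p) (hq0 : ∀ j, 0 ≤ q j) (hq : ∑ j, q j = 1) (T : Finset (Fin n × ι)) :
    ∑ x ∈ T, p x.1 * q x.2 ≤ partialSum p #T := by
  classical
  calc ∑ x ∈ T, p x.1 * q x.2 ≤ ∑ x ∈ T.image Prod.fst ×ˢ univ, p x.1 * q x.2 :=
        sum_le_sum_of_subset_of_nonneg
          (fun x hx => mem_product.2 ⟨mem_image_of_mem _ hx, mem_univ _⟩)
          fun x _ _ => mul_nonneg (hp.1 _) (hq0 _)
    _ = ∑ i ∈ T.image Prod.fst, p i := by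
        rw [sum_product]
        simp only [← mul_sum, hq, mul_one]
    _ ≤ partialSum p #T := sum_le_partialSum hp.1 hp.2.1 _ card_image_le

lemma sum_mul_le_partialSum_glb {n : ℕ} {p q r : Fin n → ℝ} (hp : IsProbVec p)
    (hq : IsProbVec q) (hr : IsProbVec r)
    (hglb : ∀ k : ℕ, k ≤ n → partialSum r k = min (partialSum p k) (partialSum q k))
    (T : Finset (Fin n × Fin n)) : ∑ x ∈ T, p x.1 * q x.2 ≤ partialSum r #T := by
  have h1 := sum_mul_le_partialSum hp hq.1 hq.2.2 T
  have h2 := sum_mul_le_partialSum hq hp.1 hp.2.2 (T.map (Equiv.prodComm _ _).toEmbedding)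
  rw [sum_map, card_map] at h2
  simp only [Equiv.coe_toEmbedding, Equiv.prodComm_apply, Prod.fst_swap, Prod.snd_swap,
    mul_comm (q _)] at h2
  rcases le_total #T n with h | h
  · rw [hglb _ h]
    exact le_min h1 h2
  · rwa [partialSum_of_le r h, hr.2.2, ← hp.2.2, ← partialSum_of_le p h]

lemma sum_rpow_pos {n : ℕ} {p : Fin n → ℝ} (hp : IsProbVec p) (α : ℝ) : 0 < ∑ i, p i ^ α := by
  obtain ⟨i, _, hi⟩ := exists_ne_zero_of_sum_ne_zero (hp.2.2.trans_ne one_ne_zero)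
  exact sum_pos' (fun j _ => rpow_nonneg (hp.1 j) α)
    ⟨i, mem_univ i, rpow_pos_of_pos (lt_of_le_of_ne (hp.1 i) hi.symm) α⟩

lemma rpow_sum_rpow_le_one {n : ℕ} {p : Fin n → ℝ} {α β : ℝ} (hp : IsProbVec p) (hα : α ≠ 1)
    (hβ : 1 < β) : (∑ i, p i ^ α) ^ ((1 - β) / (1 - α)) ≤ 1 := by
  have hp1 : ∀ i, p i ≤ 1 := fun i =>
    (single_le_sum (fun j _ => hp.1 j) (mem_univ i)).trans_eq hp.2.2
  rcases lt_or_gt_of_ne hα with h | h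
  · refine rpow_le_one_of_one_le_of_nonpos ?_
      (div_nonpos_of_nonpos_of_nonneg (by linarith) (by linarith))
    rw [← hp.2.2]
    refine sum_le_sum fun i _ => ?_
    rcases (hp.1 i).eq_or_lt with hi | hi
    · rw [← hi]; exact rpow_nonneg le_rfl α
    · simpa using rpow_le_rpow_of_exponent_ge hi (hp1 i) h.le
  · refine rpow_le_one (sum_rpow_pos hp α).le ?_
      (div_nonneg_of_nonpos (by linarith) (by linarith))
    rw [← hp.2.2]
    refine sum_le_sum fun i _ => ?_
    rcases (hp.1 i).eq_or_lt with hi | hi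
    · rw [← hi, zero_rpow (by linarith)]
    · simpa using rpow_le_rpow_of_exponent_ge hi (hp1 i) h.le

/-- For `α ≥ 0`, `α ≠ 1`, `β > 1`, the Sharma–Mittal entropy is subadditive on the
majorization lattice: `S(p ∧ q) ≤ S(p) + S(q)`. -/
theorem sharmaMittal_subadditive {n : ℕ} (α β : ℝ) (hα0 : 0 ≤ α) (hα1 : α ≠ 1)
    (hβ : 1 < β) (p q r : Fin n → ℝ)
    (hp : IsProbVec p) (hq : IsProbVec q) (hr : IsProbVec r)
    (hglb : ∀ k : ℕ, k ≤ n → partialSum r k = min (partialSum p k) (partialSum q k)) :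
    sharmaMittal α β r ≤ sharmaMittal α β p + sharmaMittal α β q := by
  have hP := rpow_sum_rpow_le_one hp hα1 hβ
  have hQ := rpow_sum_rpow_le_one hq hα1 hβ
  suffices hmain : (∑ i, p i ^ α) ^ ((1 - β) / (1 - α)) + (∑ i, q i ^ α) ^ ((1 - β) / (1 - α)) ≤
      1 + (∑ i, r i ^ α) ^ ((1 - β) / (1 - α)) by
    have hneg : 1 / (1 - β) ≤ 0 := one_div_nonpos.2 (by linarith)
    unfold sharmaMittal
    rw [← mul_add]
    exact mul_le_mul_of_nonpos_left (by linarith) hneg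
  rcases hα0.eq_or_lt with rfl | hα0
  · simp only [rpow_zero] at hP ⊢
    linarith
  have hprod : ∑ x : Fin n × Fin n, (p x.1 * q x.2) ^ α = (∑ i, p i ^ α) * ∑ i, q i ^ α := by
    rw [sum_mul_sum, Fintype.sum_prod_type]
    exact sum_congr rfl fun i _ => sum_congr rfl fun j _ => mul_rpow (hp.1 i) (hq.1 j)
  have hone : ∑ x : Fin n × Fin n, p x.1 * q x.2 = 1 := by
    rw [Fintype.sum_prod_type, ← sum_mul_sum, hp.2.2, hq.2.2, one_mul]
  have hmaj := sum_rpow_majorization (x := fun x : Fin n × Fin n => p x.1 * q x.2)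
    (fun x => mul_nonneg (hp.1 _) (hq.1 _)) hone hr
    (sum_mul_le_partialSum_glb hp hq hr hglb) hα0
  rw [hprod] at hmaj
  have hp' := sum_rpow_pos hp α
  have hq' := sum_rpow_pos hq α
  have hpq : (∑ i, p i ^ α) ^ ((1 - β) / (1 - α)) * (∑ i, q i ^ α) ^ ((1 - β) / (1 - α)) ≤
      (∑ i, r i ^ α) ^ ((1 - β) / (1 - α)) := by
    rw [← mul_rpow hp'.le hq'.le]
    rcases lt_or_gt_of_ne hα1 with h | h
    · exact rpow_le_rpow_of_nonpos (sum_rpow_pos hr α) (hmaj.2 h)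
        (div_nonpos_of_nonpos_of_nonneg (by linarith) (by linarith))
    · exact rpow_le_rpow (mul_pos hp' hq').le (hmaj.1 h)
        (div_nonneg_of_nonpos (by linarith) (by linarith))
  linarith [mul_nonneg (sub_nonneg.2 hP) (sub_nonneg.2 hQ)]
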